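/- For every skew brace B, the following statements are equivalent: (1) B is a soluble skew brace; (2) the associated solution (B, r_B) is a soluble solution; (3) the structure skew brace G_B of (B, r_B) is a soluble skew brace. -/

import Mathlib

/-!
Common definitions: skew braces, set-theoretic solutions of the Yang–Baxter
equation, structure skew braces, ideals, i-homomorphisms, solubility.
-/

universe u v

/-- A skew (left) brace: two group structures `(B,+)` and `(B,·)` sharing the
same identity `0`, with `a·(b+c) = a·b − a + a·c`. -/
structure SkewBrace (B : Type u) where
  add : B → B → B
  zero : B
  neg : B → B
  mul : B → B → B
  inv : B → B
  add_assoc : ∀ a b c, add (add a b) c = add a (add b c)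
  zero_add : ∀ a, add zero a = a
  add_zero : ∀ a, add a zero = a
  neg_add : ∀ a, add (neg a) a = zero
  add_neg : ∀ a, add a (neg a) = zero
  mul_assoc : ∀ a b c, mul (mul a b) c = mul a (mul b c)
  zero_mul : ∀ a, mul zero a = a
  mul_zero : ∀ a, mul a zero = a
  inv_mul : ∀ a, mul (inv a) a = zero
  mul_inv : ∀ a, mul a (inv a) = zero
  compat : ∀ a b c, mul a (add b c) = add (add (mul a b) (neg a)) (mul a c)

namespace SkewBrace

variable {B : Type u} (S : SkewBrace B)

/-- `λ_a(b) = −a + a·b`. -/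
def lam (a b : B) : B := S.add (S.neg a) (S.mul a b)

/-- `ρ_b(a) = λ_a(b)⁻¹ · a · b`. -/
def rho (b a : B) : B := S.mul (S.mul (S.inv (S.lam a b)) a) b

/-- The solution of the YBE associated with a skew brace:
`r_B(a,b) = (λ_a(b), ρ_b(a))`. -/
def rB : B × B → B × B := fun p => (S.lam p.1 p.2, S.rho p.2 p.1)

end SkewBrace

/-- Homomorphism of skew braces: preserves both operations. -/
def IsHom {B : Type u} {C : Type v} (S : SkewBrace B) (T : SkewBrace C) (f : B → C) : Prop :=
  (∀ a b, f (S.add a b) = T.add (f a) (f b)) ∧ (∀ a b, f (S.mul a b) = T.mul (f a) (f b))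

/-- The kernel of a skew brace homomorphism: preimage of `0`. -/
def brKer {B : Type u} {C : Type v} (T : SkewBrace C) (f : B → C) : Set B :=
  {a | f a = T.zero}

/-- An ideal of a skew brace: a sub-skew brace, normal in both `(B,+)` and `(B,·)`,
and `λ_b`-invariant for all `b`. -/
def IsIdeal {B : Type u} (S : SkewBrace B) (I : Set B) : Prop :=
  S.zero ∈ I ∧
  (∀ a ∈ I, ∀ b ∈ I, S.add a b ∈ I) ∧ (∀ a ∈ I, S.neg a ∈ I) ∧
  (∀ a ∈ I, ∀ b ∈ I, S.mul a b ∈ I) ∧ (∀ a ∈ I, S.inv a ∈ I) ∧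
  (∀ b : B, ∀ a ∈ I, S.add (S.add b a) (S.neg b) ∈ I) ∧
  (∀ b : B, ∀ a ∈ I, S.mul (S.mul b a) (S.inv b) ∈ I) ∧
  (∀ b : B, S.lam b '' I = I)

/-- A skew brace is simple if it is non-trivial and its only ideals are `{0}` and `B`. -/
def IsSimpleBrace {B : Type u} (S : SkewBrace B) : Prop :=
  (∃ a : B, a ≠ S.zero) ∧
  ∀ I : Set B, IsIdeal S I → I = {S.zero} ∨ I = Set.univ

/-- The socle of a skew brace: elements `a` with `λ_a = id` commuting additively
with everything. -/
def Soc {B : Type u} (S : SkewBrace B) : Set B :=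
  {a | (∀ b, S.lam a b = b) ∧ (∀ b, S.add a b = S.add b a)}

/-- `r × id` on triples. -/
def rOne {X : Type u} (r : X × X → X × X) : X × X × X → X × X × X :=
  fun p => ((r (p.1, p.2.1)).1, (r (p.1, p.2.1)).2, p.2.2)

/-- `id × r` on triples. -/
def rTwo {X : Type u} (r : X × X → X × X) : X × X × X → X × X × X :=
  fun p => (p.1, r p.2)

/-- `(X,r)` is a set-theoretic solution of the Yang–Baxter equation. -/
def IsSolution {X : Type u} (r : X × X → X × X) : Prop :=
  Function.Bijective r ∧
  rOne r ∘ rTwo r ∘ rOne r = rTwo r ∘ rOne r ∘ rTwo r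

/-- `λ_x(y)` for a solution, i.e. the first component of `r(x,y)`. -/
def lamMap {X : Type u} (r : X × X → X × X) (x : X) : X → X := fun y => (r (x, y)).1

/-- `ρ_y(x)` for a solution, i.e. the second component of `r(x,y)`. -/
def rhoMap {X : Type u} (r : X × X → X × X) (y : X) : X → X := fun x => (r (x, y)).2

/-- Non-degeneracy: all `λ_x` and `ρ_y` are bijective. -/
def Nondeg {X : Type u} (r : X × X → X × X) : Prop :=
  (∀ x, Function.Bijective (lamMap r x)) ∧ (∀ y, Function.Bijective (rhoMap r y))

/-- Homomorphism of solutions: `(f×f)∘r = s∘(f×f)`. -/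
def IsSolHom {X : Type u} {Y : Type v} (r : X × X → X × X) (s : Y × Y → Y × Y)
    (f : X → Y) : Prop :=
  Prod.map f f ∘ r = s ∘ Prod.map f f

/-- The structure skew brace `(G_X, ι)` of a solution `(X,r)`: the image of `ι`
generates `(G_X,·)`, `ι` intertwines `r` with `r_{G_X}`, and the pair has the
universal property for maps into skew braces. -/
structure StructureBrace {X : Type u} (r : X × X → X × X) where
  G : Type u
  S : SkewBrace G
  ι : X → G
  gen : ∀ H : Set G, S.zero ∈ H → (∀ a ∈ H, ∀ b ∈ H, S.mul a b ∈ H) →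
      (∀ a ∈ H, S.inv a ∈ H) → Set.range ι ⊆ H → H = Set.univ
  compat : Prod.map ι ι ∘ r = S.rB ∘ Prod.map ι ι
  univ : ∀ {C : Type u} (T : SkewBrace C) (g : X → C),
      Prod.map g g ∘ r = T.rB ∘ Prod.map g g →
      ∃! h : G → C, IsHom S T h ∧ h ∘ ι = g

/-- The multiplicative subgroup (as a set) generated by a subset. -/
def mulClosure {B : Type u} (S : SkewBrace B) (A : Set B) : Set B :=
  ⋂₀ {H : Set B | S.zero ∈ H ∧ (∀ a ∈ H, ∀ b ∈ H, S.mul a b ∈ H) ∧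
      (∀ a ∈ H, S.inv a ∈ H) ∧ A ⊆ H}

/-- The additive subgroup (as a set) generated by a subset. -/
def addClosure {B : Type u} (S : SkewBrace B) (A : Set B) : Set B :=
  ⋂₀ {H : Set B | S.zero ∈ H ∧ (∀ a ∈ H, ∀ b ∈ H, S.add a b ∈ H) ∧
      (∀ a ∈ H, S.neg a ∈ H) ∧ A ⊆ H}

/-- The ideal generated by a subset: intersection of all ideals containing it. -/
def idealClosure {B : Type u} (S : SkewBrace B) (A : Set B) : Set B :=
  ⋂₀ {I : Set B | IsIdeal S I ∧ A ⊆ I}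

/-- Product of two subsets in the multiplicative group. -/
def setMul {B : Type u} (S : SkewBrace B) (A₁ A₂ : Set B) : Set B :=
  {c | ∃ a ∈ A₁, ∃ b ∈ A₂, c = S.mul a b}

/-- Sum of two subsets in the additive group. -/
def setAdd {B : Type u} (S : SkewBrace B) (A₁ A₂ : Set B) : Set B :=
  {c | ∃ a ∈ A₁, ∃ b ∈ A₂, c = S.add a b}

/-- The multiplicative left coset `a·I`. -/
def lCoset {B : Type u} (S : SkewBrace B) (a : B) (I : Set B) : Set B :=
  (fun w => S.mul a w) '' I

/-- Equivalence class of the kernel relation of a map. -/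
def kerClass {X : Type u} {Y : Type v} (f : X → Y) (x : X) : Set X := {z | f z = f x}

/-- `X₀` is an i-kernel of the homomorphism of solutions `f : (X,r) → (Y,s)`:
`f` is a homomorphism of solutions, `X₀` is an equivalence class of `ker f`, and
for every class `Z` of `ker f`, `r(X₀ × Z) = Z × X₀` and `r(Z × X₀) = X₀ × Z`.
A homomorphism admitting such a class is an i-homomorphism. -/
def IsIKernel {X : Type u} {Y : Type v} (r : X × X → X × X) (s : Y × Y → Y × Y)
    (f : X → Y) (X₀ : Set X) : Prop :=
  IsSolHom r s f ∧ (∃ x : X, X₀ = kerClass f x) ∧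
  ∀ z : X, r '' (X₀ ×ˢ kerClass f z) = (kerClass f z) ×ˢ X₀ ∧
           r '' ((kerClass f z) ×ˢ X₀) = X₀ ×ˢ (kerClass f z)

/-- A strong left ideal: a `λ`-invariant subgroup of `(B,+)` which is normal
in `(B,+)`. -/
def IsStrongLeftIdeal {B : Type u} (S : SkewBrace B) (I : Set B) : Prop :=
  S.zero ∈ I ∧ (∀ a ∈ I, ∀ b ∈ I, S.add a b ∈ I) ∧ (∀ a ∈ I, S.neg a ∈ I) ∧
  (∀ b : B, S.lam b '' I = I) ∧
  (∀ b : B, ∀ a ∈ I, S.add (S.add b a) (S.neg b) ∈ I)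

/-- An abelian ideal: an ideal on which the two operations coincide and are
commutative (so it is an abelian/trivial skew brace). -/
def IsAbelianIdeal {C : Type u} (T : SkewBrace C) (J : Set C) : Prop :=
  IsIdeal T J ∧ ∀ a ∈ J, ∀ b ∈ J, T.mul a b = T.add a b ∧ T.add a b = T.add b a

/-- Solubility of a skew brace: epimorphisms `f_k : B → B_k`, `0 ≤ k ≤ t`, with
`Ker f_t = 0 ⊆ … ⊆ Ker f_0 = B` and `f_k(Ker f_{k−1})` an abelian ideal of `B_k`. -/
def IsSoluble {B : Type u} (S : SkewBrace B) : Prop :=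
  ∃ (t : ℕ) (C : Fin (t + 1) → Type u) (T : ∀ k, SkewBrace (C k)) (f : ∀ k, B → C k),
    (∀ k, IsHom S (T k) (f k) ∧ Function.Surjective (f k)) ∧
    brKer (T (Fin.last t)) (f (Fin.last t)) = {S.zero} ∧
    brKer (T 0) (f 0) = Set.univ ∧
    (∀ k : Fin t, brKer (T k.succ) (f k.succ) ⊆ brKer (T k.castSucc) (f k.castSucc)) ∧
    (∀ k : Fin t, IsAbelianIdeal (T k.succ) (f k.succ '' brKer (T k.castSucc) (f k.castSucc)))

/-- Solubility of a solution `(X,r)` (with structure skew brace `(G_X, ι)`):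
there are skew braces `B_0,…,B_t`, i-epimorphisms `f_k : (X,r) → (B_k, r_{B_k})`
with i-kernels `X_k` for `0 ≤ k ≤ t−1`, and an epimorphism `f_t`, such that
`ker f_k ⊆ ker f_{k−1}`, `ker f_0` is total, `ker f_t ⊆ ker ι`, and each
`f_k(X_{k−1})` lies in an abelian ideal `J` of `B_k` with `f_k(x)·J = f_k(y)·J`
whenever `x (ker f_{k−1}) y`. -/
def IsSolubleSolution {X : Type u} (r : X × X → X × X) (GX : StructureBrace r) : Prop :=
  ∃ (t : ℕ) (C : Fin (t + 1) → Type u) (T : ∀ k, SkewBrace (C k))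
    (f : ∀ k : Fin (t + 1), X → C k) (Xk : Fin t → Set X),
    (∀ k : Fin (t + 1), IsSolHom r (T k).rB (f k) ∧ Function.Surjective (f k)) ∧
    (∀ k : Fin t, IsIKernel r (T k.castSucc).rB (f k.castSucc) (Xk k)) ∧
    (∀ x y : X, f 0 x = f 0 y) ∧
    (∀ k : Fin t, ∀ x y : X, f k.succ x = f k.succ y → f k.castSucc x = f k.castSucc y) ∧
    (∀ x y : X, f (Fin.last t) x = f (Fin.last t) y → GX.ι x = GX.ι y) ∧
    (∀ k : Fin t, ∃ J : Set (C k.succ), IsAbelianIdeal (T k.succ) J ∧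
      f k.succ '' (Xk k) ⊆ J ∧
      ∀ x y : X, f k.castSucc x = f k.castSucc y →
        lCoset (T k.succ) (f k.succ x) J = lCoset (T k.succ) (f k.succ y) J)

/-- Decomposability of a solution: `X = Y ∪ Z` with `Y, Z` proper and
`r(Y×Y) = Y×Y`, `r(Z×Z) = Z×Z`. -/
def Decomposable {X : Type u} (r : X × X → X × X) : Prop :=
  ∃ Y Z : Set X, Y ≠ Set.univ ∧ Z ≠ Set.univ ∧ Y ∪ Z = Set.univ ∧
    r '' (Y ×ˢ Y) = Y ×ˢ Y ∧ r '' (Z ×ˢ Z) = Z ×ˢ Z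

attribute [simp] SkewBrace.add_assoc SkewBrace.zero_add SkewBrace.add_zero
  SkewBrace.neg_add SkewBrace.add_neg SkewBrace.mul_assoc SkewBrace.zero_mul SkewBrace.mul_zero
  SkewBrace.inv_mul SkewBrace.mul_inv

namespace SkewBrace

section Algebra

variable {B : Type u} (S : SkewBrace B)

@[simp] theorem neg_add_cancel_left (a b : B) : S.add (S.neg a) (S.add a b) = b := by
  rw [← S.add_assoc]; simp

@[simp] theorem add_neg_cancel_left (a b : B) : S.add a (S.add (S.neg a) b) = b := by
  rw [← S.add_assoc]; simp

@[simp] theorem inv_mul_cancel_left (a b : B) : S.mul (S.inv a) (S.mul a b) = b := by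
  rw [← S.mul_assoc]; simp

@[simp] theorem mul_inv_cancel_left (a b : B) : S.mul a (S.mul (S.inv a) b) = b := by
  rw [← S.mul_assoc]; simp

theorem add_left_cancel {a b c : B} (h : S.add a b = S.add a c) : b = c := by
  rw [← S.neg_add_cancel_left a b, h, S.neg_add_cancel_left]

theorem mul_left_cancel {a b c : B} (h : S.mul a b = S.mul a c) : b = c := by
  rw [← S.inv_mul_cancel_left a b, h, S.inv_mul_cancel_left]

@[simp] theorem neg_neg (a : B) : S.neg (S.neg a) = a :=
  S.add_left_cancel (a := S.neg a) (by simp)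

@[simp] theorem inv_inv (a : B) : S.inv (S.inv a) = a :=
  S.mul_left_cancel (a := S.inv a) (by simp)

@[simp] theorem neg_zero : S.neg S.zero = S.zero :=
  S.add_left_cancel (a := S.zero) (by simp)

@[simp] theorem inv_zero : S.inv S.zero = S.zero :=
  S.mul_left_cancel (a := S.zero) (by simp)

@[simp] theorem neg_add_rev (a b : B) :
    S.neg (S.add a b) = S.add (S.neg b) (S.neg a) :=
  S.add_left_cancel (a := S.add a b) (by simp)

@[simp] theorem inv_mul_rev (a b : B) :
    S.inv (S.mul a b) = S.mul (S.inv b) (S.inv a) :=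
  S.mul_left_cancel (a := S.mul a b) (by simp)

theorem mul_eq_add_lam (a b : B) : S.mul a b = S.add a (S.lam a b) := by
  simp [lam]

@[simp] theorem lam_zero_left (b : B) : S.lam S.zero b = b := by
  simp [lam]

@[simp] theorem lam_zero_right (a : B) : S.lam a S.zero = S.zero := by
  simp [lam]

theorem lam_add (a b c : B) : S.lam a (S.add b c) = S.add (S.lam a b) (S.lam a c) := by
  simp [lam, S.compat]

theorem lam_neg (a b : B) : S.lam a (S.neg b) = S.neg (S.lam a b) :=
  S.add_left_cancel (a := S.lam a b) (by rw [← lam_add]; simp)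

theorem lam_mul (a b c : B) : S.lam (S.mul a b) c = S.lam a (S.lam b c) := by
  conv_rhs => rw [lam.eq_def S b c, lam_add, lam_neg]
  simp [lam]

@[simp] theorem lam_inv_lam (a b : B) : S.lam (S.inv a) (S.lam a b) = b := by
  rw [← lam_mul]; simp

@[simp] theorem lam_lam_inv (a b : B) : S.lam a (S.lam (S.inv a) b) = b := by
  rw [← lam_mul]; simp

theorem inv_eq_neg_lam (a : B) : S.inv a = S.neg (S.lam (S.inv a) a) := by
  simp [lam]

theorem lam_mul_right (k a b : B) :
    S.lam k (S.mul a b) = S.add (S.lam k a) (S.lam (S.mul k a) b) := by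
  rw [mul_eq_add_lam, lam_add, lam_mul]

theorem lam_inv_right (k a : B) :
    S.lam k (S.inv a) = S.neg (S.lam (S.mul k (S.inv a)) a) := by
  rw [lam_mul, ← lam_neg, ← inv_eq_neg_lam]

theorem lam_mul_rho (a b : B) : S.mul (S.lam a b) (S.rho b a) = S.mul a b := by
  simp [rho]

theorem rB_injective : Function.Injective S.rB := by
  rintro ⟨a, b⟩ ⟨c, d⟩ h
  obtain ⟨h₁, h₂⟩ := Prod.mk.inj h
  have hm : S.mul a b = S.mul c d := by
    rw [← S.lam_mul_rho a b, ← S.lam_mul_rho c d]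
    exact congrArg₂ S.mul h₁ h₂
  have hac : a = c := by
    have key : ∀ x y : B, x = S.add (S.mul x y) (S.neg (S.lam x y)) := by
      intro x y; simp [lam]
    have h₁' : S.lam a b = S.lam c d := h₁
    rw [key a b, key c d, hm, h₁']
  subst hac
  rw [S.mul_left_cancel hm]

theorem rB_surjective : Function.Surjective S.rB := by
  rintro ⟨u, v⟩
  have hl : S.lam (S.add (S.mul u v) (S.neg u))
      (S.mul (S.inv (S.add (S.mul u v) (S.neg u))) (S.mul u v)) = u := by
    simp [lam]
  refine ⟨(S.add (S.mul u v) (S.neg u),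
    S.mul (S.inv (S.add (S.mul u v) (S.neg u))) (S.mul u v)), Prod.ext hl ?_⟩
  simp only [rB, rho, hl]
  simp

/-- Congruence modulo a subset of the additive group. -/
def Cong (I : Set B) (a b : B) : Prop := S.add (S.neg a) b ∈ I

theorem cong_iff_inv_mul {I : Set B} (hI : IsIdeal S I) (a b : B) :
    S.Cong I a b ↔ S.mul (S.inv a) b ∈ I := by
  have key : S.add (S.neg a) b = S.lam a (S.mul (S.inv a) b) := by simp [lam]
  have hl := hI.2.2.2.2.2.2.2
  unfold Cong
  constructor
  · intro h
    have : S.lam (S.inv a) (S.add (S.neg a) b) ∈ I := by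
      rw [← hl (S.inv a)]; exact ⟨_, h, rfl⟩
    rwa [key, lam_inv_lam] at this
  · intro h
    rw [key, ← hl a]; exact ⟨_, h, rfl⟩

end Algebra

end SkewBrace

section Ideals

variable {B : Type u} {C : Type v} {S : SkewBrace B} {T : SkewBrace C}

theorem isIdeal_of_closed {I : Set B} (h0 : S.zero ∈ I)
    (hadd : ∀ a ∈ I, ∀ b ∈ I, S.add a b ∈ I) (hneg : ∀ a ∈ I, S.neg a ∈ I)
    (hna : ∀ b : B, ∀ a ∈ I, S.add (S.add b a) (S.neg b) ∈ I)
    (hnm : ∀ b : B, ∀ a ∈ I, S.mul (S.mul b a) (S.inv b) ∈ I)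
    (hlam : ∀ b : B, ∀ a ∈ I, S.lam b a ∈ I) : IsIdeal S I := by
  refine ⟨h0, hadd, hneg, ?_, ?_, hna, hnm, ?_⟩
  · intro a ha b hb
    rw [S.mul_eq_add_lam]
    exact hadd _ ha _ (hlam _ _ hb)
  · intro a ha
    rw [S.inv_eq_neg_lam]
    exact hneg _ (hlam _ _ ha)
  · intro b
    refine Set.Subset.antisymm ?_ ?_
    · rintro _ ⟨a, ha, rfl⟩
      exact hlam b a ha
    · intro a ha
      exact ⟨S.lam (S.inv b) a, hlam _ _ ha, by simp⟩

theorem IsIdeal.lam_mem {I : Set B} (hI : IsIdeal S I) (b : B) {a : B} (ha : a ∈ I) :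
    S.lam b a ∈ I := by
  rw [← hI.2.2.2.2.2.2.2 b]; exact ⟨a, ha, rfl⟩

theorem isIdeal_univ : IsIdeal S (Set.univ : Set B) :=
  isIdeal_of_closed trivial (fun _ _ _ _ => trivial) (fun _ _ => trivial)
    (fun _ _ _ => trivial) (fun _ _ _ => trivial) (fun _ _ _ => trivial)

theorem isIdeal_zero : IsIdeal S {S.zero} := by
  apply isIdeal_of_closed <;> simp

namespace IsHom

variable {f : B → C} (hf : IsHom S T f)
include hf

theorem map_zero : f S.zero = T.zero :=
  T.add_left_cancel (a := f S.zero) (by rw [← hf.1]; simp)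

theorem map_neg (a : B) : f (S.neg a) = T.neg (f a) :=
  T.add_left_cancel (a := f a) (by rw [← hf.1]; simp [hf.map_zero])

theorem map_inv (a : B) : f (S.inv a) = T.inv (f a) :=
  T.mul_left_cancel (a := f a) (by rw [← hf.2]; simp [hf.map_zero])

theorem map_lam (a b : B) : f (S.lam a b) = T.lam (f a) (f b) := by
  simp only [SkewBrace.lam, hf.1, hf.2, hf.map_neg]

theorem map_rho (a b : B) : f (S.rho b a) = T.rho (f b) (f a) := by
  simp only [SkewBrace.rho, hf.2, hf.map_inv, hf.map_lam]

theorem isSolHom : IsSolHom S.rB T.rB f := by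
  funext p
  exact Prod.ext (hf.map_lam _ _) (hf.map_rho _ _)

theorem eq_of_neg_add {a b : B} (h : f (S.add (S.neg a) b) = T.zero) : f a = f b := by
  rw [hf.1, hf.map_neg] at h
  exact (T.add_left_cancel (a := T.neg (f a)) (by rw [h, T.neg_add])).symm

theorem neg_add_mem {a b : B} (h : f a = f b) : S.add (S.neg a) b ∈ brKer T f := by
  simp [brKer, hf.1, hf.map_neg, h]

theorem isIdeal_preimage {I : Set C} (hI : IsIdeal T I) : IsIdeal S (f ⁻¹' I) := by
  obtain ⟨h0, hadd, hneg, -, -, hna, hnm, -⟩ := id hI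
  refine isIdeal_of_closed ?_ ?_ ?_ ?_ ?_ ?_
  · simpa [hf.map_zero] using h0
  · intro a ha b hb
    simpa [hf.1] using hadd _ ha _ hb
  · intro a ha
    simpa [hf.map_neg] using hneg _ ha
  · intro b a ha
    simpa [hf.1, hf.map_neg] using hna (f b) _ ha
  · intro b a ha
    simpa [hf.2, hf.map_inv] using hnm (f b) _ ha
  · intro b a ha
    simpa [hf.map_lam] using hI.lam_mem (f b) ha

theorem isIdeal_image (hs : Function.Surjective f) {I : Set B} (hI : IsIdeal S I) :
    IsIdeal T (f '' I) := by
  obtain ⟨h0, hadd, hneg, -, -, hna, hnm, -⟩ := id hI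
  refine isIdeal_of_closed ⟨_, h0, hf.map_zero⟩ ?_ ?_ ?_ ?_ ?_
  · rintro _ ⟨a, ha, rfl⟩ _ ⟨b, hb, rfl⟩
    exact ⟨_, hadd _ ha _ hb, hf.1 _ _⟩
  · rintro _ ⟨a, ha, rfl⟩
    exact ⟨_, hneg _ ha, hf.map_neg _⟩
  · intro b
    obtain ⟨b, rfl⟩ := hs b
    rintro _ ⟨a, ha, rfl⟩
    exact ⟨_, hna b _ ha, by rw [hf.1, hf.1, hf.map_neg]⟩
  · intro b
    obtain ⟨b, rfl⟩ := hs b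
    rintro _ ⟨a, ha, rfl⟩
    exact ⟨_, hnm b _ ha, by rw [hf.2, hf.2, hf.map_inv]⟩
  · intro b
    obtain ⟨b, rfl⟩ := hs b
    rintro _ ⟨a, ha, rfl⟩
    exact ⟨_, hI.lam_mem b ha, hf.map_lam _ _⟩

theorem isIdeal_brKer : IsIdeal S (brKer T f) :=
  hf.isIdeal_preimage isIdeal_zero

/-- A homomorphism of skew braces is an i-homomorphism with i-kernel its kernel. -/
theorem isIKernel : IsIKernel S.rB T.rB f (brKer T f) := by
  have hr : ∀ p, T.rB (f p.1, f p.2) = (f (S.rB p).1, f (S.rB p).2) := fun p =>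
    (congrFun hf.isSolHom p).symm
  have hl : ∀ c, T.rB (T.zero, c) = (c, T.zero) := by
    intro c; simp [SkewBrace.rB, SkewBrace.rho]
  have hz : ∀ c, T.rB (c, T.zero) = (T.zero, c) := by
    intro c; simp [SkewBrace.rB, SkewBrace.rho]
  refine ⟨hf.isSolHom, ⟨S.zero, by simp [kerClass, brKer, hf.map_zero]⟩, fun z => ⟨?_, ?_⟩⟩
  · ext q
    constructor
    · rintro ⟨p, ⟨h₁, h₂⟩, rfl⟩
      have := hr p
      rw [show f p.1 = T.zero from h₁, show f p.2 = f z from h₂, hl] at this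
      exact ⟨(Prod.mk.inj this).1.symm, (Prod.mk.inj this).2.symm⟩
    · rintro ⟨h₁, h₂⟩
      obtain ⟨p, rfl⟩ := S.rB_surjective q
      have := hr p
      rw [show f (S.rB p).1 = f z from h₁, show f (S.rB p).2 = T.zero from h₂, ← hl] at this
      have := Prod.mk.inj (T.rB_injective this)
      exact ⟨p, ⟨this.1, this.2⟩, rfl⟩
  · ext q
    constructor
    · rintro ⟨p, ⟨h₁, h₂⟩, rfl⟩
      have := hr p
      rw [show f p.1 = f z from h₁, show f p.2 = T.zero from h₂, hz] at this
      exact ⟨(Prod.mk.inj this).1.symm, (Prod.mk.inj this).2.symm⟩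
    · rintro ⟨h₁, h₂⟩
      obtain ⟨p, rfl⟩ := S.rB_surjective q
      have := hr p
      rw [show f (S.rB p).1 = T.zero from h₁, show f (S.rB p).2 = f z from h₂, ← hz] at this
      have := Prod.mk.inj (T.rB_injective this)
      exact ⟨p, ⟨this.1, this.2⟩, rfl⟩

end IsHom

end Ideals

section Quotients

variable {B : Type u} (S : SkewBrace B)

/-- The congruence defined by an ideal. -/
def idealSetoid (I : Set B) (hI : IsIdeal S I) : Setoid B where
  r := S.Cong I
  iseqv := by
    obtain ⟨h0, hadd, hneg, -⟩ := hI
    refine ⟨fun a => ?_, fun {a b} h => ?_, fun {a b c} h h' => ?_⟩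
    · simpa [SkewBrace.Cong] using h0
    · simpa [SkewBrace.Cong] using hneg _ h
    · simpa [SkewBrace.Cong] using hadd _ h _ h'

theorem cong_add {I : Set B} (hI : IsIdeal S I) {a b c d : B} (h : S.Cong I a b)
    (h' : S.Cong I c d) : S.Cong I (S.add a c) (S.add b d) := by
  obtain ⟨-, hadd, -, -, -, hna, -⟩ := hI
  simpa [SkewBrace.Cong] using hadd _ (hna (S.neg c) _ h) _ h'

theorem cong_mul {I : Set B} (hI : IsIdeal S I) {a b c d : B} (h : S.Cong I a b)
    (h' : S.Cong I c d) : S.Cong I (S.mul a c) (S.mul b d) := by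
  rw [S.cong_iff_inv_mul hI] at *
  obtain ⟨-, -, -, hmul, -, -, hnm, -⟩ := hI
  simpa using hmul _ (hnm (S.inv c) _ h) _ h'

theorem cong_neg {I : Set B} (hI : IsIdeal S I) {a b : B} (h : S.Cong I a b) :
    S.Cong I (S.neg a) (S.neg b) := by
  obtain ⟨-, -, hneg, -, -, hna, -⟩ := hI
  simpa [SkewBrace.Cong] using hna a _ (hneg _ h)

theorem cong_inv {I : Set B} (hI : IsIdeal S I) {a b : B} (h : S.Cong I a b) :
    S.Cong I (S.inv a) (S.inv b) := by
  rw [S.cong_iff_inv_mul hI] at *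
  obtain ⟨-, -, -, -, hinv, -, hnm, -⟩ := hI
  simpa using hnm a _ (hinv _ h)

/-- The quotient of a skew brace by an ideal. -/
def quotBrace (I : Set B) (hI : IsIdeal S I) : SkewBrace (Quotient (idealSetoid S I hI)) where
  add := Quotient.map₂ S.add fun _ _ h _ _ h' => cong_add S hI h h'
  zero := Quotient.mk _ S.zero
  neg := Quotient.map S.neg fun _ _ h => cong_neg S hI h
  mul := Quotient.map₂ S.mul fun _ _ h _ _ h' => cong_mul S hI h h'
  inv := Quotient.map S.inv fun _ _ h => cong_inv S hI h
  add_assoc := by rintro ⟨a⟩ ⟨b⟩ ⟨c⟩; exact congrArg (Quotient.mk _) (S.add_assoc a b c)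
  zero_add := by rintro ⟨a⟩; exact congrArg (Quotient.mk _) (S.zero_add a)
  add_zero := by rintro ⟨a⟩; exact congrArg (Quotient.mk _) (S.add_zero a)
  neg_add := by rintro ⟨a⟩; exact congrArg (Quotient.mk _) (S.neg_add a)
  add_neg := by rintro ⟨a⟩; exact congrArg (Quotient.mk _) (S.add_neg a)
  mul_assoc := by rintro ⟨a⟩ ⟨b⟩ ⟨c⟩; exact congrArg (Quotient.mk _) (S.mul_assoc a b c)
  zero_mul := by rintro ⟨a⟩; exact congrArg (Quotient.mk _) (S.zero_mul a)
  mul_zero := by rintro ⟨a⟩; exact congrArg (Quotient.mk _) (S.mul_zero a)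
  inv_mul := by rintro ⟨a⟩; exact congrArg (Quotient.mk _) (S.inv_mul a)
  mul_inv := by rintro ⟨a⟩; exact congrArg (Quotient.mk _) (S.mul_inv a)
  compat := by rintro ⟨a⟩ ⟨b⟩ ⟨c⟩; exact congrArg (Quotient.mk _) (S.compat a b c)

/-- The quotient map. -/
def quotMap (I : Set B) (hI : IsIdeal S I) : B → Quotient (idealSetoid S I hI) :=
  Quotient.mk _

theorem quotMap_isHom (I : Set B) (hI : IsIdeal S I) :
    IsHom S (quotBrace S I hI) (quotMap S I hI) :=
  ⟨fun _ _ => rfl, fun _ _ => rfl⟩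

theorem quotMap_surjective (I : Set B) (hI : IsIdeal S I) :
    Function.Surjective (quotMap S I hI) :=
  Quotient.mk_surjective

theorem quotMap_eq_iff (I : Set B) (hI : IsIdeal S I) (a b : B) :
    quotMap S I hI a = quotMap S I hI b ↔ S.Cong I a b :=
  Quotient.eq (r := idealSetoid S I hI)

theorem brKer_quotMap (I : Set B) (hI : IsIdeal S I) :
    brKer (quotBrace S I hI) (quotMap S I hI) = I := by
  ext a
  have h : a ∈ brKer (quotBrace S I hI) (quotMap S I hI) ↔
      quotMap S I hI S.zero = quotMap S I hI a := eq_comm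
  rw [h, quotMap_eq_iff]
  simp [SkewBrace.Cong]

end Quotients

section Series

/-- `I / J` is abelian as a skew brace. -/
def AbelianMod {B : Type u} (S : SkewBrace B) (I J : Set B) : Prop :=
  ∀ a ∈ I, ∀ b ∈ I, S.Cong J (S.mul a b) (S.add a b) ∧ S.Cong J (S.add a b) (S.add b a)

/-- Ideals reached from the whole skew brace by a finite descending chain of ideals with
abelian factors. -/
inductive SolubleIndex {B : Type u} (S : SkewBrace B) : Set B → Prop
  | univ : SolubleIndex S Set.univ
  | step (I J : Set B) : SolubleIndex S I → IsIdeal S J → J ⊆ I → AbelianMod S I J →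
      SolubleIndex S J

variable {B : Type u} {C : Type v} {S : SkewBrace B} {T : SkewBrace C}

theorem SolubleIndex.preimage {f : B → C} (hf : IsHom S T f) {I : Set C}
    (h : SolubleIndex T I) : SolubleIndex S (f ⁻¹' I) := by
  induction h with
  | univ => exact .univ
  | step I J _ hJ hJI hab ih =>
    refine .step _ _ ih (hf.isIdeal_preimage hJ) (Set.preimage_mono hJI) fun a ha b hb => ?_
    simpa [SkewBrace.Cong, hf.1, hf.2, hf.map_neg] using hab _ ha _ hb

theorem SolubleIndex.image {f : B → C} (hf : IsHom S T f) (hs : Function.Surjective f)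
    {I : Set B} (h : SolubleIndex S I) : SolubleIndex T (f '' I) := by
  induction h with
  | univ => rw [Set.image_univ, hs.range_eq]; exact .univ
  | step I J _ hJ hJI hab ih =>
    refine .step _ _ ih (hf.isIdeal_image hs hJ) (Set.image_mono hJI) ?_
    rintro _ ⟨a, ha, rfl⟩ _ ⟨b, hb, rfl⟩
    obtain ⟨h₁, h₂⟩ := hab _ ha _ hb
    exact ⟨⟨_, h₁, by simp only [hf.1, hf.2, hf.map_neg]⟩,
      ⟨_, h₂, by simp only [hf.1, hf.map_neg]⟩⟩

theorem SolubleIndex.of_surjective {f : B → C} (hf : IsHom S T f) (hs : Function.Surjective f)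
    (h : SolubleIndex S {S.zero}) : SolubleIndex T {T.zero} := by
  simpa [hf.map_zero] using h.image hf hs

theorem SolubleIndex.of_abelian_brKer {f : B → C} (hf : IsHom S T f)
    (hab : ∀ a ∈ brKer T f, ∀ b ∈ brKer T f, S.mul a b = S.add a b ∧ S.add a b = S.add b a)
    (h : SolubleIndex T {T.zero}) : SolubleIndex S {S.zero} := by
  refine .step _ _ (h.preimage hf) isIdeal_zero ?_ ?_
  · rintro _ rfl
    exact hf.map_zero
  · intro a ha b hb
    obtain ⟨h₁, h₂⟩ := hab a ha b hb
    constructor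
    · simp [SkewBrace.Cong, h₁]
    · rw [h₂]; simp [SkewBrace.Cong]

theorem SolubleIndex.exists_series {J : Set B} (h : SolubleIndex S J) :
    ∃ (t : ℕ) (I : ℕ → Set B), I 0 = Set.univ ∧ I t = J ∧ (∀ k, IsIdeal S (I k)) ∧
      ∀ k, k < t → I (k + 1) ⊆ I k ∧ AbelianMod S (I k) (I (k + 1)) := by
  induction h with
  | univ =>
    exact ⟨0, fun _ => Set.univ, rfl, rfl, fun _ => isIdeal_univ, fun k hk => by omega⟩
  | step K J _ hJ hJK hab ih =>
    obtain ⟨t, I, h0, ht, hI, hs⟩ := ih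
    refine ⟨t + 1, fun k => if k ≤ t then I k else J, by simp [h0], by simp, ?_, ?_⟩
    · intro k
      dsimp only
      split_ifs
      · exact hI k
      · exact hJ
    · intro k hk
      rcases Nat.lt_or_ge k t with hk' | hk'
      · simpa [hk'.le, Nat.succ_le_of_lt hk'] using hs k hk'
      · obtain rfl : k = t := by omega
        simpa [ht] using And.intro hJK hab

theorem isSoluble_iff : IsSoluble S ↔ SolubleIndex S {S.zero} := by
  constructor
  · rintro ⟨t, C, T, f, hf, hlast, h0, hsub, hab⟩
    have key : ∀ k, SolubleIndex S (brKer (T k) (f k)) := by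
      intro k
      induction k using Fin.induction with
      | zero => rw [h0]; exact .univ
      | succ k ih =>
        refine .step _ _ ih (hf _).1.isIdeal_brKer (hsub k) fun a ha b hb => ?_
        obtain ⟨h₁, h₂⟩ := (hab k).2 _ ⟨a, ha, rfl⟩ _ ⟨b, hb, rfl⟩
        rw [← (hf k.succ).1.1, ← (hf k.succ).1.2] at h₁
        rw [← (hf k.succ).1.1, ← (hf k.succ).1.1] at h₂
        exact ⟨(hf _).1.neg_add_mem h₁, (hf _).1.neg_add_mem h₂⟩
    rw [← hlast]
    exact key _
  · intro h
    obtain ⟨t, I, h0, ht, hI, hs⟩ := h.exists_series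
    refine ⟨t, fun k => Quotient (idealSetoid S (I k) (hI k)), fun k => quotBrace S (I k) (hI k),
      fun k => quotMap S (I k) (hI k), fun k => ⟨quotMap_isHom S _ _, quotMap_surjective S _ _⟩,
      ?_, ?_, ?_, ?_⟩
    · rw [brKer_quotMap, Fin.val_last, ht]
    · rw [brKer_quotMap, Fin.val_zero, h0]
    · intro k
      rw [brKer_quotMap, brKer_quotMap]
      exact (hs k k.2).1
    · intro k
      rw [brKer_quotMap]
      refine ⟨(quotMap_isHom S _ _).isIdeal_image (quotMap_surjective S _ _) (hI _), ?_⟩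
      rintro _ ⟨a, ha, rfl⟩ _ ⟨b, hb, rfl⟩
      obtain ⟨h₁, h₂⟩ := (hs k k.2).2 a ha b hb
      rw [← (quotMap_isHom S _ _).1, ← (quotMap_isHom S _ _).1, ← (quotMap_isHom S _ _).2]
      exact ⟨(quotMap_eq_iff S _ _ _ _).2 h₁, (quotMap_eq_iff S _ _ _ _).2 h₂⟩

end Series

section Envelope

theorem mulClosure_induction {B : Type u} {S : SkewBrace B} {A : Set B} (P : B → Prop)
    (h0 : P S.zero) (hmul : ∀ a b, P a → P b → P (S.mul a b)) (hinv : ∀ a, P a → P (S.inv a))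
    (hA : ∀ a ∈ A, P a) {x : B} (hx : x ∈ mulClosure S A) : P x :=
  hx {x | P x} ⟨h0, fun a ha b hb => hmul a b ha hb, hinv, hA⟩

section Closed

variable {B : Type u} (S : SkewBrace B) (A : Set B)

theorem subset_mulClosure : A ⊆ mulClosure S A := fun _ ha _ hH => hH.2.2.2 ha

theorem zero_mem_mulClosure : S.zero ∈ mulClosure S A := fun _ hH => hH.1

variable {S A}

theorem mul_mem_mulClosure {a b : B} (ha : a ∈ mulClosure S A) (hb : b ∈ mulClosure S A) :
    S.mul a b ∈ mulClosure S A := fun H hH => hH.2.1 _ (ha H hH) _ (hb H hH)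

theorem inv_mem_mulClosure {a : B} (ha : a ∈ mulClosure S A) :
    S.inv a ∈ mulClosure S A := fun H hH => hH.2.2.1 _ (ha H hH)

end Closed

variable {B : Type u} {E : Type v} {S : SkewBrace B} {P : SkewBrace E} {i : B → E} {h : E → B}

theorem IsSolHom.map_lam (hi : IsSolHom S.rB P.rB i) (a b : B) :
    i (S.lam a b) = P.lam (i a) (i b) :=
  (Prod.mk.inj (congrFun hi (a, b))).1

theorem IsSolHom.map_rho (hi : IsSolHom S.rB P.rB i) (a b : B) :
    i (S.rho b a) = P.rho (i b) (i a) :=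
  (Prod.mk.inj (congrFun hi (a, b))).2

variable (hi : IsSolHom S.rB P.rB i) (hh : IsHom P S h) (hhi : ∀ b, h (i b) = b)
include hi hh hhi

theorem lam_section {g : E} (hg : g ∈ mulClosure P (Set.range i)) (b : B) :
    P.lam g (i b) = i (S.lam (h g) b) := by
  revert b
  refine mulClosure_induction (fun g => ∀ b, P.lam g (i b) = i (S.lam (h g) b)) ?_ ?_ ?_ ?_ hg
  · intro b; simp [hh.map_zero]
  · intro a c ha hc b
    rw [P.lam_mul, hc, ha, hh.2, S.lam_mul]
  · intro a ha b
    have := ha (S.lam (S.inv (h a)) b)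
    rw [S.lam_lam_inv] at this
    rw [← this, P.lam_inv_lam, hh.map_inv]
  · rintro _ ⟨a, rfl⟩ b
    rw [hhi, hi.map_lam]

/-- An additively closed subset containing the section contains the multiplicative subgroup
generated by the section. -/
theorem mulClosure_subset_of_add_closed {Q : Set E} (h0 : P.zero ∈ Q)
    (hadd : ∀ a ∈ Q, ∀ b ∈ Q, P.add a b ∈ Q) (hneg : ∀ a ∈ Q, P.neg a ∈ Q)
    (hQ : ∀ b, i b ∈ Q) : mulClosure P (Set.range i) ⊆ Q := by
  intro x hx
  have key : x ∈ mulClosure P (Set.range i) ∧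
      ∀ k ∈ mulClosure P (Set.range i), P.lam k x ∈ Q := by
    refine mulClosure_induction (fun x => x ∈ mulClosure P (Set.range i) ∧
      ∀ k ∈ mulClosure P (Set.range i), P.lam k x ∈ Q) ?_ ?_ ?_ ?_ hx
    · exact ⟨zero_mem_mulClosure P _, fun k _ => by simpa using h0⟩
    · rintro a b ⟨ha, ha'⟩ ⟨hb, hb'⟩
      refine ⟨mul_mem_mulClosure ha hb, fun k hk => ?_⟩
      rw [P.lam_mul_right]
      exact hadd _ (ha' k hk) _ (hb' _ (mul_mem_mulClosure hk ha))
    · rintro a ⟨ha, ha'⟩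
      refine ⟨inv_mem_mulClosure ha, fun k hk => ?_⟩
      rw [P.lam_inv_right]
      exact hneg _ (ha' _ (mul_mem_mulClosure hk (inv_mem_mulClosure ha)))
    · rintro _ ⟨b, rfl⟩
      refine ⟨subset_mulClosure P _ ⟨b, rfl⟩, fun k hk => ?_⟩
      rw [lam_section hi hh hhi hk]
      exact hQ _
  simpa using key.2 _ (zero_mem_mulClosure P _)

theorem add_sub_mem_mulClosure {x : E} (hx : x ∈ mulClosure P (Set.range i)) :
    ∀ m ∈ mulClosure P (Set.range i), P.add m x ∈ mulClosure P (Set.range i) ∧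
      P.add m (P.neg x) ∈ mulClosure P (Set.range i) := by
  refine mulClosure_subset_of_add_closed hi hh hhi
    (Q := {x | ∀ m ∈ mulClosure P (Set.range i), P.add m x ∈ mulClosure P (Set.range i) ∧
      P.add m (P.neg x) ∈ mulClosure P (Set.range i)}) ?_ ?_ ?_ ?_ hx
  · intro m hm; simpa using hm
  · intro a ha b hb m hm
    refine ⟨?_, ?_⟩
    · rw [← P.add_assoc]; exact (hb _ (ha _ hm).1).1
    · rw [P.neg_add_rev, ← P.add_assoc]; exact (ha _ (hb _ hm).2).2
  · intro a ha m hm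
    rw [P.neg_neg]; exact (ha m hm).symm
  · intro b m hm
    have hadd : ∀ y, P.add m y = P.mul m (P.lam (P.inv m) y) := by
      intro y; rw [P.mul_eq_add_lam, P.lam_lam_inv]
    have hm' := inv_mem_mulClosure hm
    refine ⟨?_, ?_⟩
    · rw [hadd, lam_section hi hh hhi hm']
      exact mul_mem_mulClosure hm (subset_mulClosure P _ ⟨_, rfl⟩)
    · rw [hadd, P.lam_neg, lam_section hi hh hhi hm']
      refine mul_mem_mulClosure hm ?_
      have hneg : ∀ c, P.neg (i c) = P.inv (i (S.inv (S.neg c))) := by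
        intro c
        rw [P.inv_eq_neg_lam, lam_section hi hh hhi
          (inv_mem_mulClosure (subset_mulClosure P _ ⟨_, rfl⟩)), hh.map_inv, hhi]
        simp [SkewBrace.lam]
      rw [hneg]
      exact inv_mem_mulClosure (subset_mulClosure P _ ⟨_, rfl⟩)

omit hh hhi in
theorem add_section_comm (a b : B) :
    P.add (i a) (i b) = P.add (i b) (i (S.add (S.neg b) (S.add a b))) := by
  have hb : S.lam a (S.lam (S.inv a) b) = b := S.lam_lam_inv a b
  set c := S.lam (S.inv a) b with hc
  have e₁ : S.lam b (S.rho c a) = S.add (S.neg b) (S.add a b) := by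
    have := S.lam_mul_rho a c
    rw [hb] at this
    rw [SkewBrace.lam, this, S.mul_eq_add_lam, hb]
  have e₂ := P.lam_mul_rho (i a) (i c)
  rw [← hi.map_lam, ← hi.map_rho, hb, P.mul_eq_add_lam, P.mul_eq_add_lam (i a), ← hi.map_lam,
    ← hi.map_lam, hb, e₁] at e₂
  exact e₂.symm

theorem section_add_comm {g : E} (hg : g ∈ mulClosure P (Set.range i)) (a : B) :
    P.add (i a) g = P.add g (i (S.add (S.neg (h g)) (S.add a (h g)))) := by
  revert a
  refine mulClosure_subset_of_add_closed hi hh hhi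
    (Q := {g | ∀ a, P.add (i a) g = P.add g (i (S.add (S.neg (h g)) (S.add a (h g))))})
    ?_ ?_ ?_ ?_ hg
  · intro a; simp [hh.map_zero]
  · intro x hx y hy a
    rw [← P.add_assoc, hx, P.add_assoc, hy, hh.1]
    simp
  · intro x hx a
    have := hx (S.add (h x) (S.add a (S.neg (h x))))
    simp only [S.add_assoc, S.neg_add, S.add_zero, S.neg_add_cancel_left] at this
    refine P.add_left_cancel (a := x) ?_
    rw [← P.add_assoc, ← this]
    simp [hh.map_neg]
  · rintro b a
    rw [hhi, add_section_comm hi]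

/-- The kernel of a retraction onto a skew brace acts trivially on what the section
generates. -/
theorem lam_eq_self_of_brKer {g x : E} (hg : g ∈ mulClosure P (Set.range i))
    (hg0 : h g = S.zero) (hx : x ∈ mulClosure P (Set.range i)) : P.lam g x = x := by
  refine mulClosure_subset_of_add_closed hi hh hhi (Q := {x | P.lam g x = x}) ?_ ?_ ?_ ?_ hx
  · simp
  · intro a ha b hb
    exact (P.lam_add _ _ _).trans (congrArg₂ P.add ha hb)
  · intro a ha
    exact (P.lam_neg _ _).trans (congrArg P.neg ha)
  · intro b
    show P.lam g (i b) = i b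
    rw [lam_section hi hh hhi hg, hg0, S.lam_zero_left]

theorem add_comm_of_brKer {g x : E} (hg : g ∈ mulClosure P (Set.range i))
    (hg0 : h g = S.zero) (hx : x ∈ mulClosure P (Set.range i)) : P.add x g = P.add g x := by
  refine mulClosure_subset_of_add_closed hi hh hhi (Q := {x | P.add x g = P.add g x})
    ?_ ?_ ?_ ?_ hx
  · simp
  · intro a ha b hb
    show P.add (P.add a b) g = P.add g (P.add a b)
    rw [P.add_assoc, show P.add b g = _ from hb, ← P.add_assoc, show P.add a g = _ from ha,
      P.add_assoc]
  · intro a ha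
    refine P.add_left_cancel (a := a) ?_
    rw [P.add_neg_cancel_left, ← P.add_assoc, show P.add a g = _ from ha]
    simp
  · intro b
    show P.add (i b) g = P.add g (i b)
    rw [section_add_comm hi hh hhi hg, hg0]
    simp

/-- The sub-skew brace generated by the section. -/
def sectionBrace : SkewBrace (mulClosure P (Set.range i)) where
  add a b := ⟨P.add a b, (add_sub_mem_mulClosure hi hh hhi b.2 _ a.2).1⟩
  zero := ⟨P.zero, zero_mem_mulClosure P _⟩
  neg a := ⟨P.neg a, by
    simpa using (add_sub_mem_mulClosure hi hh hhi a.2 _ (zero_mem_mulClosure P _)).2⟩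
  mul a b := ⟨P.mul a b, mul_mem_mulClosure a.2 b.2⟩
  inv a := ⟨P.inv a, inv_mem_mulClosure a.2⟩
  add_assoc _ _ _ := Subtype.ext (P.add_assoc _ _ _)
  zero_add _ := Subtype.ext (P.zero_add _)
  add_zero _ := Subtype.ext (P.add_zero _)
  neg_add _ := Subtype.ext (P.neg_add _)
  add_neg _ := Subtype.ext (P.add_neg _)
  mul_assoc _ _ _ := Subtype.ext (P.mul_assoc _ _ _)
  zero_mul _ := Subtype.ext (P.zero_mul _)
  mul_zero _ := Subtype.ext (P.mul_zero _)
  inv_mul _ := Subtype.ext (P.inv_mul _)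
  mul_inv _ := Subtype.ext (P.mul_inv _)
  compat _ _ _ := Subtype.ext (P.compat _ _ _)

theorem SolubleIndex.sectionBrace (hS : SolubleIndex S {S.zero}) :
    SolubleIndex (sectionBrace hi hh hhi) {(sectionBrace hi hh hhi).zero} := by
  refine SolubleIndex.of_abelian_brKer (T := S) (f := fun x => h x)
    ⟨fun _ _ => hh.1 _ _, fun _ _ => hh.2 _ _⟩ (fun a ha b hb => ⟨?_, ?_⟩) hS
  · refine Subtype.ext ?_
    show P.mul a b = P.add a b
    rw [P.mul_eq_add_lam, lam_eq_self_of_brKer hi hh hhi a.2 ha b.2]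
  · exact Subtype.ext (add_comm_of_brKer hi hh hhi b.2 hb a.2)

end Envelope

/-- The direct product of two skew braces. -/
def prodBrace {B : Type u} {C : Type v} (S : SkewBrace B) (T : SkewBrace C) :
    SkewBrace (B × C) where
  add a b := (S.add a.1 b.1, T.add a.2 b.2)
  zero := (S.zero, T.zero)
  neg a := (S.neg a.1, T.neg a.2)
  mul a b := (S.mul a.1 b.1, T.mul a.2 b.2)
  inv a := (S.inv a.1, T.inv a.2)
  add_assoc _ _ _ := Prod.ext (S.add_assoc _ _ _) (T.add_assoc _ _ _)
  zero_add _ := Prod.ext (S.zero_add _) (T.zero_add _)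
  add_zero _ := Prod.ext (S.add_zero _) (T.add_zero _)
  neg_add _ := Prod.ext (S.neg_add _) (T.neg_add _)
  add_neg _ := Prod.ext (S.add_neg _) (T.add_neg _)
  mul_assoc _ _ _ := Prod.ext (S.mul_assoc _ _ _) (T.mul_assoc _ _ _)
  zero_mul _ := Prod.ext (S.zero_mul _) (T.zero_mul _)
  mul_zero _ := Prod.ext (S.mul_zero _) (T.mul_zero _)
  inv_mul _ := Prod.ext (S.inv_mul _) (T.inv_mul _)
  mul_inv _ := Prod.ext (S.mul_inv _) (T.mul_inv _)
  compat _ _ _ := Prod.ext (S.compat _ _ _) (T.compat _ _ _)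

/-- Solubility of skew braces passes along epimorphisms of the associated solutions. -/
theorem SolubleIndex.of_isSolHom {B : Type u} {C : Type v} {S : SkewBrace B} {T : SkewBrace C}
    {φ : B → C} (hφ : IsSolHom S.rB T.rB φ) (hs : Function.Surjective φ)
    (h : SolubleIndex S {S.zero}) : SolubleIndex T {T.zero} := by
  have hi : IsSolHom S.rB (prodBrace S T).rB fun b => (b, φ b) := by
    funext p
    exact Prod.ext (Prod.ext rfl (hφ.map_lam p.1 p.2)) (Prod.ext rfl (hφ.map_rho p.1 p.2))
  have hh : IsHom (prodBrace S T) S Prod.fst := ⟨fun _ _ => rfl, fun _ _ => rfl⟩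
  refine (h.sectionBrace hi hh fun _ => rfl).of_surjective (f := fun x => x.1.2)
    ⟨fun _ _ => rfl, fun _ _ => rfl⟩ fun c => ?_
  obtain ⟨b, rfl⟩ := hs c
  exact ⟨⟨(b, φ b), subset_mulClosure _ _ ⟨b, rfl⟩⟩, rfl⟩

theorem StructureBrace.exists_retraction {B : Type u} {S : SkewBrace B}
    (GB : StructureBrace S.rB) : ∃ h : GB.G → B, IsHom GB.S S h ∧ ∀ b, h (GB.ι b) = b := by
  obtain ⟨h, ⟨hh, hi⟩, -⟩ := GB.univ S id rfl
  exact ⟨h, hh, congrFun hi⟩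

theorem lCoset_eq_of_inv_mul_mem {B : Type u} {S : SkewBrace B} {J : Set B} (hJ : IsIdeal S J)
    {a b : B} (h : S.mul (S.inv a) b ∈ J) : lCoset S a J = lCoset S b J := by
  obtain ⟨-, -, -, hmul, hinv, -⟩ := hJ
  refine Set.Subset.antisymm ?_ ?_
  · rintro _ ⟨w, hw, rfl⟩
    exact ⟨_, hmul _ (hinv _ h) _ hw, by simp⟩
  · rintro _ ⟨w, hw, rfl⟩
    exact ⟨_, hmul _ h _ hw, by simp⟩

theorem IsSoluble.isSolubleSolution {B : Type u} {S : SkewBrace B} (GB : StructureBrace S.rB)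
    (h : IsSoluble S) : IsSolubleSolution S.rB GB := by
  obtain ⟨t, C, T, f, hf, hlast, h0, hsub, hab⟩ := h
  refine ⟨t, C, T, f, fun k => brKer (T k.castSucc) (f k.castSucc),
    fun k => ⟨(hf k).1.isSolHom, (hf k).2⟩, fun k => (hf _).1.isIKernel, ?_, ?_, ?_, ?_⟩
  · intro x y
    have : ∀ x, f 0 x = (T 0).zero := fun x => h0.symm.subset (Set.mem_univ x)
    rw [this, this]
  · intro k x y hxy
    exact (hf _).1.eq_of_neg_add (hsub k ((hf _).1.neg_add_mem hxy))
  · intro x y hxy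
    have : S.add (S.neg x) y = S.zero := hlast.subset ((hf _).1.neg_add_mem hxy)
    rw [S.add_left_cancel (this.trans (S.neg_add x).symm)]
  · intro k
    refine ⟨_, hab k, subset_rfl, fun x y hxy => lCoset_eq_of_inv_mul_mem (hab k).1 ?_⟩
    refine ⟨S.mul (S.inv x) y, ?_, by rw [(hf _).1.2, (hf _).1.map_inv]⟩
    show f k.castSucc _ = _
    rw [(hf _).1.2, (hf _).1.map_inv, hxy, SkewBrace.inv_mul]

theorem IsSolubleSolution.isSoluble {B : Type u} {S : SkewBrace B} {GB : StructureBrace S.rB}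
    (h : IsSolubleSolution S.rB GB) : IsSoluble S := by
  obtain ⟨t, C, T, f, Xk, hf, -, h0, -, hlast, hab⟩ := h
  have key : ∀ k, SolubleIndex (T k) {(T k).zero} := by
    intro k
    induction k using Fin.induction with
    | zero =>
      have : ({(T 0).zero} : Set (C 0)) = Set.univ := by
        refine Set.eq_univ_of_forall fun c => ?_
        obtain ⟨x, rfl⟩ := (hf 0).2 c
        obtain ⟨y, hy⟩ := (hf 0).2 (T 0).zero
        rw [← hy]
        exact h0 x y
      rw [this]
      exact .univ
    | succ k ih =>
      obtain ⟨J, ⟨hJ, hJab⟩, -, hcos⟩ := hab k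
      set π := quotMap (T k.succ) J hJ
      have hπ : IsHom (T k.succ) _ π := quotMap_isHom (T k.succ) J hJ
      have hfac : ∀ x y, f k.castSucc x = f k.castSucc y → π (f k.succ x) = π (f k.succ y) := by
        intro x y hxy
        have hmem : f k.succ y ∈ lCoset (T k.succ) (f k.succ x) J := by
          rw [hcos x y hxy]
          exact ⟨_, hJ.1, SkewBrace.mul_zero _ _⟩
        obtain ⟨j, hj, hj'⟩ := hmem
        refine (quotMap_eq_iff _ _ _ _ _).2 ((SkewBrace.cong_iff_inv_mul _ hJ _ _).2 ?_)
        rw [← hj']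
        simpa using hj
      let φ := fun c => π (f k.succ (Function.surjInv (hf k.castSucc).2 c))
      have hφ : ∀ x, φ (f k.castSucc x) = π (f k.succ x) := fun x =>
        hfac _ _ (Function.surjInv_eq _ _)
      have hsol : IsSolHom (T k.castSucc).rB (quotBrace (T k.succ) J hJ).rB φ := by
        funext ⟨c, d⟩
        obtain ⟨x, rfl⟩ := (hf k.castSucc).2 c
        obtain ⟨y, rfl⟩ := (hf k.castSucc).2 d
        refine Prod.ext ?_ ?_
        · show φ ((T k.castSucc).lam _ _) = (quotBrace (T k.succ) J hJ).lam (φ _) (φ _)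
          rw [← (hf k.castSucc).1.map_lam, hφ, hφ, hφ, (hf k.succ).1.map_lam, hπ.map_lam]
        · show φ ((T k.castSucc).rho _ _) = (quotBrace (T k.succ) J hJ).rho (φ _) (φ _)
          rw [← (hf k.castSucc).1.map_rho, hφ, hφ, hφ, (hf k.succ).1.map_rho, hπ.map_rho]
      have hsurj : Function.Surjective φ := by
        intro c
        obtain ⟨d, rfl⟩ := quotMap_surjective _ _ _ c
        obtain ⟨x, rfl⟩ := (hf k.succ).2 d
        exact ⟨_, hφ x⟩
      refine SolubleIndex.of_abelian_brKer hπ ?_ (ih.of_isSolHom hsol hsurj)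
      rw [brKer_quotMap]
      exact hJab
  obtain ⟨r, -, hr⟩ := GB.exists_retraction
  have hinj : Function.Injective (f (Fin.last t)) := fun x y hxy => by
    rw [← hr x, ← hr y, hlast x y hxy]
  let e := Equiv.ofBijective _ ⟨hinj, (hf (Fin.last t)).2⟩
  have he : ∀ x, e.symm (f (Fin.last t) x) = x := e.symm_apply_apply
  refine isSoluble_iff.2 ((key (Fin.last t)).of_isSolHom (φ := e.symm) ?_ e.symm.surjective)
  funext ⟨c, d⟩
  obtain ⟨x, rfl⟩ := (hf (Fin.last t)).2 c
  obtain ⟨y, rfl⟩ := (hf (Fin.last t)).2 d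
  refine Prod.ext ?_ ?_
  · show e.symm ((T (Fin.last t)).lam _ _) = S.lam (e.symm _) (e.symm _)
    rw [← (hf (Fin.last t)).1.map_lam, he, he, he]
  · show e.symm ((T (Fin.last t)).rho _ _) = S.rho (e.symm _) (e.symm _)
    rw [← (hf (Fin.last t)).1.map_rho, he, he, he]

theorem isSoluble_structureBrace_iff {B : Type u} {S : SkewBrace B}
    (GB : StructureBrace S.rB) : IsSoluble GB.S ↔ IsSoluble S := by
  obtain ⟨h, hh, hi⟩ := GB.exists_retraction
  rw [isSoluble_iff, isSoluble_iff]
  refine ⟨fun H => H.of_surjective hh fun b => ⟨_, hi b⟩, fun H => ?_⟩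
  have hgen : mulClosure GB.S (Set.range GB.ι) = Set.univ :=
    GB.gen _ (zero_mem_mulClosure _ _) (fun _ ha _ hb => mul_mem_mulClosure ha hb)
      (fun _ ha => inv_mem_mulClosure ha) (subset_mulClosure _ _)
  exact (H.sectionBrace GB.compat hh hi).of_surjective (f := Subtype.val)
    ⟨fun _ _ => rfl, fun _ _ => rfl⟩ fun g => ⟨⟨g, hgen ▸ Set.mem_univ g⟩, rfl⟩

/-- For every skew brace `B`, the following are equivalent:
(1) `B` is a soluble skew brace; (2) `(B, r_B)` is a soluble solution;
(3) the structure skew brace `G_B` is a soluble skew brace. -/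
theorem stmt_17 {B : Type u} (S : SkewBrace B) (GB : StructureBrace S.rB) :
    (IsSoluble S ↔ IsSolubleSolution S.rB GB) ∧
    (IsSolubleSolution S.rB GB ↔ IsSoluble GB.S) := by
  have h := isSoluble_structureBrace_iff GB
  have h' : IsSoluble S ↔ IsSolubleSolution S.rB GB :=
    ⟨fun H => H.isSolubleSolution GB, fun H => H.isSoluble⟩
  exact ⟨h', h'.symm.trans h.symm⟩
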